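/- Let 0 < Λ̲ ≤ Λ̄ < ∞. Then there exists a constant C̄ > 0, depending only on Λ̲ and Λ̄, such that for all λ, λ′ ∈ [Λ̲, Λ̄] and all probability mass functions p, p′ on ℕ with p(0) = p′(0) = 0 satisfying p′(i) > 0 whenever p(i) > 0 and with KL(p, p′), V(p, p′) finite, the compound Poisson distributions q, q′ of (λ, p), (λ′, p′) satisfy: KL(q, q′) ≤ C̄ (KL(p, p′) + |λ − λ′|), V(q, q′) ≤ C̄ (V(p, p′) + KL(p, p′) + (λ − λ′)²), and h(q, q′) ≤ C̄ h(p, p′) + |√λ − √λ′|. -/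

import Mathlib

open MeasureTheory
open scoped BigOperators Classical

noncomputable section

/-- Discrete convolution of two sequences. -/
def conv (a b : ℕ → ℝ) : ℕ → ℝ := fun i => ∑ k ∈ Finset.range (i + 1), a k * b (i - k)

/-- The sequence δ₀ with δ₀(0) = 1 and δ₀(k) = 0 for k ≥ 1. -/
def delta0 : ℕ → ℝ := fun i => if i = 0 then 1 else 0

/-- Convolution powers: a^{∗0} = δ₀, a^{∗(n+1)} = a^{∗n} ∗ a. -/
def convPow (a : ℕ → ℝ) : ℕ → ℕ → ℝ
  | 0 => delta0
  | n + 1 => conv (convPow a n) a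

/-- The ℓ¹ norm of a sequence. -/
def l1 (a : ℕ → ℝ) : ℝ := ∑' i, |a i|

/-- exp(a) = ∑_{j=0}^∞ a^{∗j}/j!, defined coordinatewise. -/
def expSeq (a : ℕ → ℝ) : ℕ → ℝ := fun i => ∑' j, convPow a j i / (Nat.factorial j : ℝ)

/-- p is a probability mass function on ℕ₀. -/
def IsPMF (p : ℕ → ℝ) : Prop := (∀ i, 0 ≤ p i) ∧ ∑' i, p i = 1

/-- Kullback–Leibler divergence. -/
def KL (u v : ℕ → ℝ) : ℝ := ∑' i, u i * Real.log (u i / v i)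

/-- The V divergence. -/
def Vd (u v : ℕ → ℝ) : ℝ := ∑' i, u i * (Real.log (u i / v i)) ^ 2

/-- Squared Hellinger distance. -/
def hellSq (u v : ℕ → ℝ) : ℝ := ∑' i, (Real.sqrt (u i) - Real.sqrt (v i)) ^ 2

/-- Hellinger distance. -/
def hell (u v : ℕ → ℝ) : ℝ := Real.sqrt (hellSq u v)

/-- The compound Poisson distribution of (λ, p). -/
def cpq (lam : ℝ) (p : ℕ → ℝ) : ℕ → ℝ :=
  fun i => ∑' n, Real.exp (-lam) * lam ^ n / (Nat.factorial n : ℝ) * convPow p n i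

theorem IsPMF.hasSum {p : ℕ → ℝ} (hp : IsPMF p) : HasSum p 1 := by
  have hs : Summable p := by
    by_contra h
    have := hp.2
    rw [tsum_eq_zero_of_not_summable h] at this
    norm_num at this
  simpa [hp.2] using hs.hasSum

theorem tsum_le_of_tsum_ofReal_le {ι : Type*} {f : ι → ℝ} {b : ℝ} (hf : ∀ i, 0 ≤ f i)
    (hb : 0 ≤ b) (h : ∑' i, ENNReal.ofReal (f i) ≤ ENNReal.ofReal b) :
    Summable f ∧ ∑' i, f i ≤ b := by
  have hne : ∑' i, ENNReal.ofReal (f i) ≠ ⊤ := ne_top_of_le_ne_top ENNReal.ofReal_ne_top h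
  have hs : Summable f := by
    have := ENNReal.summable_toReal hne
    simpa [ENNReal.toReal_ofReal (hf _)] using this
  refine ⟨hs, ?_⟩
  rw [← ENNReal.ofReal_tsum_of_nonneg hf hs] at h
  exact (ENNReal.ofReal_le_ofReal_iff hb).1 h

/-- A nonnegative function with supporting linear functionals, the integrand of a divergence that
decreases under marginalisation. -/
structure HasSubgradient (φ : ℝ → ℝ → ℝ) : Prop where
  nonneg : ∀ u v, 0 ≤ u → 0 ≤ v → (v = 0 → u = 0) → 0 ≤ φ u v
  map_zero : φ 0 0 = 0
  exists_le : ∀ U V, 0 ≤ U → 0 < V → ∃ α β, φ U V ≤ α * U + β * V ∧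
    ∀ u v, 0 ≤ u → 0 ≤ v → (v = 0 → u = 0) → (U = 0 → u = 0) → α * u + β * v ≤ φ u v

theorem HasSubgradient.ofReal_le_tsum {φ : ℝ → ℝ → ℝ} (hφ : HasSubgradient φ) {ι : Type*}
    {u v : ι → ℝ} {U V : ℝ} (hu : ∀ k, 0 ≤ u k) (hv : ∀ k, 0 ≤ v k) (huv : ∀ k, v k = 0 → u k = 0)
    (hU : HasSum u U) (hV : HasSum v V) :
    ENNReal.ofReal (φ U V) ≤ ∑' k, ENNReal.ofReal (φ (u k) (v k)) := by
  have hU0 : 0 ≤ U := hU.nonneg hu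
  rcases (hV.nonneg hv).eq_or_lt with hV0 | hV0
  · have hv0 : v = 0 := (hasSum_zero_iff_of_nonneg hv).1 (hV0 ▸ hV)
    have hu0 : u = 0 := funext fun k => huv k (by simp [hv0])
    subst hu0
    have : U = 0 := hU.unique hasSum_zero
    simp [this, ← hV0, hφ.map_zero]
  · obtain ⟨α, β, h1, h2⟩ := hφ.exists_le U V hU0 hV0
    have hpt : ∀ k, α * u k + β * v k ≤ φ (u k) (v k) := fun k =>
      h2 _ _ (hu k) (hv k) (huv k) fun h0 => by
        subst h0
        have : u = 0 := (hasSum_zero_iff_of_nonneg hu).1 hU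
        simp [this]
    by_cases hT : ∑' k, ENNReal.ofReal (φ (u k) (v k)) = ⊤
    · simp [hT]
    · have hn : ∀ k, 0 ≤ φ (u k) (v k) := fun k => hφ.nonneg _ _ (hu k) (hv k) (huv k)
      have hs : Summable fun k => φ (u k) (v k) := by
        have := ENNReal.summable_toReal hT
        simpa [ENNReal.toReal_ofReal (hn _)] using this
      rw [← ENNReal.ofReal_tsum_of_nonneg hn hs]
      exact ENNReal.ofReal_le_ofReal (h1.trans
        (hasSum_le hpt ((hU.mul_left α).add (hV.mul_left β)) hs.hasSum))

theorem tsum_sum_range_eq_tsum_tsum (F : ℕ → ℕ → ENNReal) :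
    ∑' i, ∑ k ∈ Finset.range (i + 1), F k (i - k) = ∑' j, ∑' k, F k j := by
  rw [ENNReal.tsum_comm, ← ENNReal.tsum_prod (f := F),
    ← Finset.HasAntidiagonal.sigmaAntidiagonalEquivProd.tsum_eq, ENNReal.tsum_sigma']
  refine tsum_congr fun i => ?_
  rw [tsum_fintype, ← Finset.Nat.sum_antidiagonal_eq_sum_range_succ F,
    ← Finset.sum_coe_sort]
  rfl

theorem convPow_nonneg {p : ℕ → ℝ} (hp : ∀ i, 0 ≤ p i) (n i : ℕ) : 0 ≤ convPow p n i := by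
  induction n generalizing i with
  | zero => simp only [convPow, delta0]; split_ifs <;> norm_num
  | succ n ih =>
    simp only [convPow, conv]
    exact Finset.sum_nonneg fun k _ => mul_nonneg (ih k) (hp _)

theorem convPow_eq_zero {p p' : ℕ → ℝ} (hp' : ∀ i, 0 ≤ p' i)
    (hac : ∀ i, p' i = 0 → p i = 0) (n i : ℕ) (h : convPow p' n i = 0) : convPow p n i = 0 := by
  induction n generalizing i with
  | zero => exact h
  | succ n ih =>
    simp only [convPow, conv] at h ⊢
    refine Finset.sum_eq_zero fun k hk => ?_
    have := (Finset.sum_eq_zero_iff_of_nonneg fun k _ =>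
      mul_nonneg (convPow_nonneg hp' n k) (hp' _)).1 h k hk
    rcases mul_eq_zero.1 this with h | h
    · simp [ih k h]
    · simp [hac _ h]

theorem tsum_ofReal_convPow {p : ℕ → ℝ} (hp : IsPMF p) (n : ℕ) :
    ∑' i, ENNReal.ofReal (convPow p n i) = 1 := by
  have hp1 : ∑' i, ENNReal.ofReal (p i) = 1 := by
    rw [← ENNReal.ofReal_tsum_of_nonneg hp.1 hp.hasSum.summable, hp.2, ENNReal.ofReal_one]
  induction n with
  | zero =>
    rw [tsum_eq_single 0 (fun i hi => by simp [convPow, delta0, hi])]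
    simp [convPow, delta0]
  | succ n ih =>
    have : ∀ i, ENNReal.ofReal (convPow p (n + 1) i) = ∑ k ∈ Finset.range (i + 1),
        ENNReal.ofReal (convPow p n k) * ENNReal.ofReal (p (i - k)) := fun i => by
      simp only [convPow, conv]
      rw [ENNReal.ofReal_sum_of_nonneg fun k _ => mul_nonneg (convPow_nonneg hp.1 n k) (hp.1 _)]
      exact Finset.sum_congr rfl fun k _ => ENNReal.ofReal_mul (convPow_nonneg hp.1 n k)
    simp_rw [this]
    rw [tsum_sum_range_eq_tsum_tsum fun k j =>
      ENNReal.ofReal (convPow p n k) * ENNReal.ofReal (p j)]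
    simp_rw [ENNReal.tsum_mul_right, ih, one_mul, hp1]

theorem hasSum_convPow {p : ℕ → ℝ} (hp : IsPMF p) (n : ℕ) : HasSum (convPow p n) 1 := by
  have h := tsum_ofReal_convPow hp n
  have hs := (tsum_le_of_tsum_ofReal_le (convPow_nonneg hp.1 n) zero_le_one (by simp [h])).1
  rw [← ENNReal.ofReal_tsum_of_nonneg (convPow_nonneg hp.1 n) hs, ENNReal.ofReal_eq_one] at h
  exact h ▸ hs.hasSum

/-- The Poisson weights. -/
def poissonWeight (lam : ℝ) (n : ℕ) : ℝ := Real.exp (-lam) * lam ^ n / (Nat.factorial n : ℝ)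

theorem poissonWeight_pos {lam : ℝ} (h : 0 < lam) (n : ℕ) : 0 < poissonWeight lam n := by
  unfold poissonWeight; positivity

theorem hasSum_poissonWeight (lam : ℝ) : HasSum (poissonWeight lam) 1 := by
  have h := (NormedSpace.expSeries_div_hasSum_exp lam).mul_left (Real.exp (-lam))
  rw [← Real.exp_eq_exp_ℝ, ← Real.exp_add, neg_add_cancel, Real.exp_zero] at h
  refine h.congr_fun ?_
  intro n
  simp [poissonWeight, mul_div_assoc]

theorem poissonWeight_succ (lam : ℝ) (n : ℕ) :
    poissonWeight lam (n + 1) * ((n + 1 : ℕ) : ℝ) = lam * poissonWeight lam n := by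
  unfold poissonWeight
  rw [Nat.factorial_succ]
  push_cast
  field_simp
  ring

theorem hasSum_poissonWeight_mul (lam : ℝ) : HasSum (fun n => poissonWeight lam n * n) lam := by
  rw [← hasSum_nat_add_iff' 1]
  simp only [poissonWeight_succ]
  simpa using (hasSum_poissonWeight lam).mul_left lam

theorem hasSum_poissonWeight_mul_sq (lam : ℝ) :
    HasSum (fun n => poissonWeight lam n * (n : ℝ) ^ 2) (lam ^ 2 + lam) := by
  rw [← hasSum_nat_add_iff' 1]
  have : ∀ n : ℕ, poissonWeight lam (n + 1) * ((n + 1 : ℕ) : ℝ) ^ 2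
      = lam * (poissonWeight lam n * n) + lam * poissonWeight lam n := fun n => by
    rw [sq, ← mul_assoc, poissonWeight_succ]; push_cast; ring
  simp only [this]
  have h := ((hasSum_poissonWeight_mul lam).mul_left lam).add
    ((hasSum_poissonWeight lam).mul_left lam)
  simpa [sq] using h

theorem hasSum_cpq_apply {lam : ℝ} {p : ℕ → ℝ} (hl : 0 < lam) (hp : IsPMF p) (i : ℕ) :
    HasSum (fun n => poissonWeight lam n * convPow p n i) (cpq lam p i) := by
  refine Summable.hasSum (Summable.of_nonneg_of_le
    (fun n => mul_nonneg (poissonWeight_pos hl n).le (convPow_nonneg hp.1 n i)) (fun n => ?_)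
    (hasSum_poissonWeight lam).summable)
  exact mul_le_of_le_one_right (poissonWeight_pos hl n).le
    (le_hasSum (hasSum_convPow hp n) i fun j _ => convPow_nonneg hp.1 n j)

theorem cpq_nonneg {lam : ℝ} {p : ℕ → ℝ} (hl : 0 < lam) (hp : IsPMF p) (i : ℕ) :
    0 ≤ cpq lam p i :=
  (hasSum_cpq_apply hl hp i).nonneg fun n =>
    mul_nonneg (poissonWeight_pos hl n).le (convPow_nonneg hp.1 n i)

theorem cpq_eq_zero {lam lam' : ℝ} {p p' : ℕ → ℝ} (hl : 0 < lam) (hl' : 0 < lam') (hp : IsPMF p)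
    (hp' : IsPMF p') (hac : ∀ i, p' i = 0 → p i = 0) (i : ℕ) (h : cpq lam' p' i = 0) :
    cpq lam p i = 0 := by
  have h0 := (hasSum_zero_iff_of_nonneg fun n =>
    mul_nonneg (poissonWeight_pos hl' n).le (convPow_nonneg hp'.1 n i)).1
      (h ▸ hasSum_cpq_apply hl' hp' i)
  refine (hasSum_cpq_apply hl hp i).unique ?_
  convert hasSum_zero with n
  rw [convPow_eq_zero hp'.1 hac n i ((mul_eq_zero.1 (congrFun h0 n)).resolve_left
    (poissonWeight_pos hl' n).ne'), mul_zero]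

theorem hasSum_cpq {lam : ℝ} {p : ℕ → ℝ} (hl : 0 < lam) (hp : IsPMF p) :
    HasSum (cpq lam p) 1 := by
  have h : ∑' i, ENNReal.ofReal (cpq lam p i) = 1 := by
    have : ∀ i, ENNReal.ofReal (cpq lam p i) = ∑' n, ENNReal.ofReal (poissonWeight lam n) *
        ENNReal.ofReal (convPow p n i) := fun i => by
      rw [← (hasSum_cpq_apply hl hp i).tsum_eq, ENNReal.ofReal_tsum_of_nonneg
        (fun n => mul_nonneg (poissonWeight_pos hl n).le (convPow_nonneg hp.1 n i))
        (hasSum_cpq_apply hl hp i).summable]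
      exact tsum_congr fun n => ENNReal.ofReal_mul (poissonWeight_pos hl n).le
    simp_rw [this]
    rw [ENNReal.tsum_comm]
    simp_rw [ENNReal.tsum_mul_left, tsum_ofReal_convPow hp, mul_one]
    rw [← ENNReal.ofReal_tsum_of_nonneg (fun n => (poissonWeight_pos hl n).le)
      (hasSum_poissonWeight lam).summable, (hasSum_poissonWeight lam).tsum_eq, ENNReal.ofReal_one]
  have hs := (tsum_le_of_tsum_ofReal_le (cpq_nonneg hl hp) zero_le_one (by simp [h])).1
  rw [← ENNReal.ofReal_tsum_of_nonneg (cpq_nonneg hl hp) hs, ENNReal.ofReal_eq_one] at h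
  exact h ▸ hs.hasSum

section Divergence

variable {φ : ℝ → ℝ → ℝ} {b : ℕ → ℝ → ℝ → ℝ} {p p' : ℕ → ℝ}

theorem HasSubgradient.tsum_convPow_le (hφ : HasSubgradient φ)
    (hp : ∀ i, 0 ≤ p i) (hp' : ∀ i, 0 ≤ p' i) (hac : ∀ i, p' i = 0 → p i = 0)
    (hb : ∀ n s t, 0 ≤ s → 0 ≤ t → (t = 0 → s = 0) → 0 ≤ b n s t)
    (hb0 : ∀ s t, 0 ≤ s → 0 ≤ t → φ s t ≤ b 0 s t)
    (hbs : ∀ n s t, 0 ≤ s → 0 ≤ t → (t = 0 → s = 0) →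
      HasSum (fun j => b n (s * p j) (t * p' j)) (b (n + 1) s t))
    (n : ℕ) (s t : ℝ) (hs : 0 ≤ s) (ht : 0 ≤ t) (hst : t = 0 → s = 0) :
    ∑' i, ENNReal.ofReal (φ (s * convPow p n i) (t * convPow p' n i))
      ≤ ENNReal.ofReal (b n s t) := by
  have hac_mul : ∀ {s t : ℝ}, (t = 0 → s = 0) → ∀ {x y : ℝ}, (y = 0 → x = 0) →
      t * y = 0 → s * x = 0 := fun h _ _ h' h0 => by
    rcases mul_eq_zero.1 h0 with h0 | h0
    · simp [h h0]
    · simp [h' h0]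
  induction n generalizing s t with
  | zero =>
    rw [tsum_eq_single 0 (fun i hi => by simp [convPow, delta0, hi, hφ.map_zero])]
    simpa [convPow, delta0] using ENNReal.ofReal_le_ofReal (hb0 s t hs ht)
  | succ n ih =>
    have hn := convPow_nonneg hp n
    have hn' := convPow_nonneg hp' n
    calc ∑' i, ENNReal.ofReal (φ (s * convPow p (n + 1) i) (t * convPow p' (n + 1) i))
        ≤ ∑' i, ∑ k ∈ Finset.range (i + 1), ENNReal.ofReal
          (φ (s * p (i - k) * convPow p n k) (t * p' (i - k) * convPow p' n k)) := by
          refine ENNReal.tsum_le_tsum fun i => ?_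
          simp only [convPow, conv, Finset.mul_sum, Finset.sum_range]
          refine (hφ.ofReal_le_tsum (ι := Fin (i + 1))
            (u := fun k => s * p (i - k) * convPow p n k)
            (v := fun k => t * p' (i - k) * convPow p' n k)
            (fun k => ?_) (fun k => ?_) (fun k => ?_) ?_ ?_).trans_eq (tsum_fintype _)
          · exact mul_nonneg (mul_nonneg hs (hp _)) (hn _)
          · exact mul_nonneg (mul_nonneg ht (hp' _)) (hn' _)
          · exact hac_mul (hac_mul hst (hac _)) (convPow_eq_zero hp' hac n _)
          · convert hasSum_fintype _ using 2
            ring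
          · convert hasSum_fintype _ using 2
            ring
      _ = ∑' j, ∑' k, ENNReal.ofReal
          (φ (s * p j * convPow p n k) (t * p' j * convPow p' n k)) :=
          tsum_sum_range_eq_tsum_tsum fun k j => ENNReal.ofReal
            (φ (s * p j * convPow p n k) (t * p' j * convPow p' n k))
      _ ≤ ∑' j, ENNReal.ofReal (b n (s * p j) (t * p' j)) :=
          ENNReal.tsum_le_tsum fun j => ih _ _ (mul_nonneg hs (hp j)) (mul_nonneg ht (hp' j))
            (hac_mul hst (hac j))
      _ = ENNReal.ofReal (b (n + 1) s t) := by
          rw [← ENNReal.ofReal_tsum_of_nonneg (fun j => hb _ _ _ (mul_nonneg hs (hp j))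
            (mul_nonneg ht (hp' j)) (hac_mul hst (hac j))) (hbs n s t hs ht hst).summable,
            (hbs n s t hs ht hst).tsum_eq]

/-- A divergence between compound Poisson distributions is bounded by the divergence of the
underlying Poisson mixtures. -/
theorem HasSubgradient.tsum_cpq_le (hφ : HasSubgradient φ) (hp : IsPMF p) (hp' : IsPMF p')
    (hac : ∀ i, p' i = 0 → p i = 0)
    (hb : ∀ n s t, 0 ≤ s → 0 ≤ t → (t = 0 → s = 0) → 0 ≤ b n s t)
    (hb0 : ∀ s t, 0 ≤ s → 0 ≤ t → φ s t ≤ b 0 s t)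
    (hbs : ∀ n s t, 0 ≤ s → 0 ≤ t → (t = 0 → s = 0) →
      HasSum (fun j => b n (s * p j) (t * p' j)) (b (n + 1) s t))
    {lam lam' : ℝ} (hl : 0 < lam) (hl' : 0 < lam') {B : ℝ}
    (hB : HasSum (fun n => b n (poissonWeight lam n) (poissonWeight lam' n)) B) :
    Summable (fun i => φ (cpq lam p i) (cpq lam' p' i)) ∧
      ∑' i, φ (cpq lam p i) (cpq lam' p' i) ≤ B := by
  have hw := poissonWeight_pos hl
  have hw' := poissonWeight_pos hl'
  have hbn : ∀ n, 0 ≤ b n (poissonWeight lam n) (poissonWeight lam' n) := fun n =>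
    hb _ _ _ (hw n).le (hw' n).le fun h => absurd h (hw' n).ne'
  refine tsum_le_of_tsum_ofReal_le
    (fun i => hφ.nonneg _ _ (cpq_nonneg hl hp i) (cpq_nonneg hl' hp' i)
      (cpq_eq_zero hl hl' hp hp' hac i)) (hB.nonneg hbn) ?_
  calc ∑' i, ENNReal.ofReal (φ (cpq lam p i) (cpq lam' p' i))
      ≤ ∑' i, ∑' n, ENNReal.ofReal (φ (poissonWeight lam n * convPow p n i)
        (poissonWeight lam' n * convPow p' n i)) := by
        refine ENNReal.tsum_le_tsum fun i => hφ.ofReal_le_tsum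
          (fun n => mul_nonneg (hw n).le (convPow_nonneg hp.1 n i))
          (fun n => mul_nonneg (hw' n).le (convPow_nonneg hp'.1 n i)) (fun n h => ?_)
          (hasSum_cpq_apply hl hp i) (hasSum_cpq_apply hl' hp' i)
        rw [convPow_eq_zero hp'.1 hac n i ((mul_eq_zero.1 h).resolve_left (hw' n).ne'), mul_zero]
    _ = ∑' n, ∑' i, ENNReal.ofReal (φ (poissonWeight lam n * convPow p n i)
        (poissonWeight lam' n * convPow p' n i)) := ENNReal.tsum_comm
    _ ≤ ∑' n, ENNReal.ofReal (b n (poissonWeight lam n) (poissonWeight lam' n)) :=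
        ENNReal.tsum_le_tsum fun n => hφ.tsum_convPow_le hp.1 hp'.1 hac hb hb0 hbs n _ _
          (hw n).le (hw' n).le fun h => absurd h (hw' n).ne'
    _ = ENNReal.ofReal B := by
        rw [← ENNReal.ofReal_tsum_of_nonneg hbn hB.summable, hB.tsum_eq]

end Divergence

theorem mul_mul_comp_log (g : ℝ → ℝ) {x x' y y' : ℝ} (hx : x' = 0 → x = 0) (hy : y' = 0 → y = 0) :
    x * y * g (Real.log (x * y / (x' * y')))
      = x * (y * g (Real.log (x / x') + Real.log (y / y'))) := by
  by_cases hx0 : x = 0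
  · simp [hx0]
  by_cases hy0 : y = 0
  · simp [hy0]
  rw [mul_div_mul_comm, Real.log_mul (div_ne_zero hx0 (mt hx hx0)) (div_ne_zero hy0 (mt hy hy0)),
    mul_assoc]

theorem log_poissonWeight_div {lam lam' : ℝ} (hl : 0 < lam) (hl' : 0 < lam') (n : ℕ) :
    Real.log (poissonWeight lam n / poissonWeight lam' n)
      = lam' - lam + n * Real.log (lam / lam') := by
  have : poissonWeight lam n / poissonWeight lam' n
      = Real.exp (lam' - lam) * (lam / lam') ^ n := by
    rw [sub_eq_add_neg, Real.exp_add]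
    simp only [poissonWeight, Real.exp_neg, div_pow]
    field_simp
  rw [this, Real.log_mul (Real.exp_ne_zero _) (by positivity), Real.log_exp, Real.log_pow]

/-- The integrand of the Kullback–Leibler divergence, corrected to be nonnegative. -/
def klFn (u v : ℝ) : ℝ := u * Real.log (u / v) - u + v

/-- The integrand of the part of the `V` divergence where the first argument dominates. -/
def posSqLogFn (u v : ℝ) : ℝ := u * (max (Real.log (u / v)) 0) ^ 2

/-- The integrand of the squared Hellinger distance. -/
def hellFn (u v : ℝ) : ℝ := (Real.sqrt u - Real.sqrt v) ^ 2

theorem sub_le_mul_log_div {u v : ℝ} (hu : 0 ≤ u) (hv : 0 < v) : u - v ≤ u * Real.log (u / v) := by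
  rcases hu.eq_or_lt with rfl | hu
  · simp [hv.le]
  have h := Real.log_le_sub_one_of_pos (div_pos hv hu)
  rw [← inv_div, Real.log_inv, inv_div] at h
  have h2 := mul_le_mul_of_nonneg_left h hu.le
  have h3 : u * (v / u - 1) = v - u := by field_simp
  linarith

theorem klFn_nonneg {u v : ℝ} (hu : 0 ≤ u) (hv : 0 ≤ v) (huv : v = 0 → u = 0) : 0 ≤ klFn u v := by
  rcases hv.eq_or_lt with rfl | hv
  · simp [klFn, huv rfl]
  · have := sub_le_mul_log_div hu hv
    unfold klFn
    linarith

theorem hasSubgradient_klFn : HasSubgradient klFn where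
  nonneg u v hu hv huv := klFn_nonneg hu hv huv
  map_zero := by simp [klFn]
  exists_le U V hU hV := by
    rcases hU.eq_or_lt with rfl | hU
    · refine ⟨0, 1, by simp [klFn], fun u v hu hv huv h => ?_⟩
      simp [klFn, h rfl]
    · refine ⟨Real.log (U / V), 1 - U / V, ?_, fun u v hu hv huv _ => ?_⟩
      · unfold klFn
        have : U / V * V = U := by field_simp
        linarith
      · rcases hu.eq_or_lt with rfl | hu
        · simp only [klFn]
          have : 0 ≤ U / V * v := by positivity
          linarith
        · have hv : 0 < v := hv.lt_of_ne fun h => hu.ne' (huv h.symm)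
          have h := sub_le_mul_log_div (v := U / V * v) hu.le (by positivity)
          have h2 : u / (U / V * v) = (u / v) / (U / V) := by field_simp
          rw [h2, Real.log_div (by positivity) (by positivity)] at h
          unfold klFn
          linarith

theorem hellFn_eq {u v : ℝ} (hu : 0 ≤ u) (hv : 0 ≤ v) :
    hellFn u v = u + v - 2 * (Real.sqrt u * Real.sqrt v) := by
  unfold hellFn
  linear_combination Real.sq_sqrt hu + Real.sq_sqrt hv

theorem hasSubgradient_hellFn : HasSubgradient hellFn where
  nonneg u v _ _ _ := sq_nonneg _
  map_zero := by simp [hellFn]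
  exists_le U V hU hV := by
    rcases hU.eq_or_lt with rfl | hU
    · refine ⟨0, 1, by simp [hellFn, hV.le], fun u v hu hv huv h => ?_⟩
      simp [hellFn, h rfl, hv]
    · have hU' := Real.sqrt_pos.2 hU
      have hV' := Real.sqrt_pos.2 hV
      refine ⟨1 - Real.sqrt V / Real.sqrt U, 1 - Real.sqrt U / Real.sqrt V, ?_,
        fun u v hu hv huv _ => ?_⟩
      · rw [hellFn_eq hU.le hV.le]
        have h1 : Real.sqrt V / Real.sqrt U * U = Real.sqrt U * Real.sqrt V := by
          nth_rw 2 [← Real.sq_sqrt hU.le]; field_simp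
        have h2 : Real.sqrt U / Real.sqrt V * V = Real.sqrt U * Real.sqrt V := by
          nth_rw 2 [← Real.sq_sqrt hV.le]; field_simp
        linarith
      · rw [hellFn_eq hu hv]
        have h : 0 ≤ (Real.sqrt V * Real.sqrt u - Real.sqrt U * Real.sqrt v) ^ 2
            / (Real.sqrt U * Real.sqrt V) := by positivity
        have h2 : (Real.sqrt V * Real.sqrt u - Real.sqrt U * Real.sqrt v) ^ 2
            / (Real.sqrt U * Real.sqrt V) = Real.sqrt V / Real.sqrt U * u
              + Real.sqrt U / Real.sqrt V * v - 2 * (Real.sqrt u * Real.sqrt v) := by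
          field_simp
          rw [Real.sq_sqrt hU.le, Real.sq_sqrt hV.le]
          linear_combination V * Real.sq_sqrt hu + U * Real.sq_sqrt hv
            + Real.sqrt u ^ 2 * Real.sq_sqrt hV.le + Real.sqrt v ^ 2 * Real.sq_sqrt hU.le
        linarith

theorem hasSubgradient_posSqLogFn : HasSubgradient posSqLogFn where
  nonneg u v hu _ _ := mul_nonneg hu (sq_nonneg _)
  map_zero := by simp [posSqLogFn]
  exists_le U V hU hV := by
    set L := max (Real.log (U / V)) 0 with hL
    have hL0 : 0 ≤ L := le_max_right _ _
    refine ⟨L ^ 2 + 2 * L, -(2 * (U / V) * L), ?_, fun u v hu hv huv _ => ?_⟩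
    · have : U / V * V = U := by field_simp
      unfold posSqLogFn
      rw [← hL]
      linear_combination 2 * L * this
    · rcases hL0.eq_or_lt with hL1 | hL1
      · rw [← hL1]
        simpa [posSqLogFn] using mul_nonneg hu (sq_nonneg (max (Real.log (u / v)) 0))
      · have hpos : 0 < Real.log (U / V) := by
          by_contra h
          rw [max_eq_right (not_lt.1 h)] at hL
          exact hL1.ne' hL
        have hLe : L = Real.log (U / V) := max_eq_left hpos.le
        have hU' : 0 < U := hU.lt_of_ne fun h => by simp [← h] at hpos
        have hX : U / V = Real.exp L := by rw [hLe, Real.exp_log (by positivity)]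
        rcases hu.eq_or_lt with rfl | hu
        · have : 0 ≤ U / V * L * v := by positivity
          simp only [posSqLogFn]
          linarith
        have hv : 0 < v := hv.lt_of_ne fun h => hu.ne' (huv h.symm)
        unfold posSqLogFn
        set l := Real.log (u / v) with hl
        have hx : u = Real.exp l * v := by rw [hl, Real.exp_log (by positivity)]; field_simp
        rw [hX]
        rcases le_total 0 l with h0 | h0
        · rw [max_eq_left h0]
          have h1 : u * (1 + (L - l)) ≤ Real.exp L * v := by
            have := Real.add_one_le_exp (L - l)
            calc u * (1 + (L - l)) ≤ u * Real.exp (L - l) := by gcongr; linarith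
              _ = Real.exp L * v := by rw [hx, Real.exp_sub]; field_simp
          nlinarith [mul_le_mul_of_nonneg_left h1 hL0, mul_nonneg hu.le (sq_nonneg (l - L))]
        · rw [max_eq_right h0]
          have h1 : u * (1 + L) ≤ Real.exp L * v := by
            have := Real.add_one_le_exp L
            have h2 : u ≤ v := by
              rw [hx]; exact mul_le_of_le_one_left hv.le (Real.exp_le_one_iff.2 h0)
            calc u * (1 + L) ≤ v * Real.exp L := by gcongr; linarith
              _ = _ := mul_comm _ _
          nlinarith [mul_le_mul_of_nonneg_left h1 hL0, mul_nonneg hu.le (sq_nonneg L)]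

theorem hellFn_le_klFn {u v : ℝ} (hu : 0 ≤ u) (hv : 0 ≤ v) (huv : v = 0 → u = 0) :
    hellFn u v ≤ klFn u v := by
  rcases hu.eq_or_lt with rfl | hu
  · simp [hellFn, klFn, hv]
  have hv : 0 < v := hv.lt_of_ne fun h => hu.ne' (huv h.symm)
  have hu' := Real.sqrt_pos.2 hu
  have hv' := Real.sqrt_pos.2 hv
  have h := sub_le_mul_log_div hu'.le hv'
  have h2 := mul_le_mul_of_nonneg_left h hu'.le
  rw [← mul_assoc, Real.mul_self_sqrt hu.le, ← Real.sqrt_div hu.le,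
    Real.log_sqrt (by positivity), mul_sub, Real.mul_self_sqrt hu.le] at h2
  rw [hellFn_eq hu.le hv.le]
  unfold klFn
  linarith

theorem mul_log_div_sq_le {u v : ℝ} (hu : 0 ≤ u) (hv : 0 ≤ v) :
    u * Real.log (u / v) ^ 2 ≤ posSqLogFn u v + 4 * hellFn u v := by
  rcases le_total 0 (Real.log (u / v)) with h | h
  · unfold posSqLogFn hellFn
    rw [max_eq_left h]
    linarith [sq_nonneg (Real.sqrt u - Real.sqrt v)]
  · unfold posSqLogFn hellFn
    rw [max_eq_right h]
    rcases hu.eq_or_lt with rfl | hu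
    · simp [hv]
    rcases hv.eq_or_lt with rfl | hv
    · simp [hu.le]
    have hu' := Real.sqrt_pos.2 hu
    have hv' := Real.sqrt_pos.2 hv
    have h1 := sub_le_mul_log_div hu'.le hv'
    rw [← Real.sqrt_div hu.le, Real.log_sqrt (by positivity)] at h1
    have h2 : Real.sqrt u * (Real.log (u / v) / 2) ≤ 0 :=
      mul_nonpos_of_nonneg_of_nonpos hu'.le (by linarith)
    have h3 : (Real.sqrt u * (Real.log (u / v) / 2)) ^ 2 ≤ (Real.sqrt u - Real.sqrt v) ^ 2 := by
      nlinarith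
    rw [mul_pow, Real.sq_sqrt hu.le] at h3
    linarith

section Bounds

variable {p p' : ℕ → ℝ}

theorem hasSum_klFn (hp : IsPMF p) (hp' : IsPMF p')
    (hK : Summable fun i => p i * Real.log (p i / p' i)) :
    HasSum (fun i => klFn (p i) (p' i)) (KL p p') := by
  simpa [klFn, KL] using (hK.hasSum.sub hp.hasSum).add hp'.hasSum

theorem KL_nonneg (hp : IsPMF p) (hp' : IsPMF p') (hac : ∀ i, p' i = 0 → p i = 0)
    (hK : Summable fun i => p i * Real.log (p i / p' i)) : 0 ≤ KL p p' :=
  (hasSum_klFn hp hp' hK).nonneg fun i => klFn_nonneg (hp.1 i) (hp'.1 i) (hac i)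

theorem KL_sq_le_Vd (hp : IsPMF p)
    (hK : Summable fun i => p i * Real.log (p i / p' i))
    (hV : Summable fun i => p i * Real.log (p i / p' i) ^ 2) : KL p p' ^ 2 ≤ Vd p p' := by
  have h := (hV.hasSum.sub (hK.hasSum.mul_left (2 * KL p p'))).add
    (hp.hasSum.mul_left (KL p p' ^ 2))
  have h0 := h.nonneg fun i => by
    calc 0 ≤ p i * (Real.log (p i / p' i) - KL p p') ^ 2 := mul_nonneg (hp.1 i) (sq_nonneg _)
      _ = _ := by ring
  simp only [← Vd.eq_1, ← KL.eq_1] at h0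
  linarith

theorem klFn_cpq_le (hp : IsPMF p) (hp' : IsPMF p') (hac : ∀ i, p' i = 0 → p i = 0)
    (hK : Summable fun i => p i * Real.log (p i / p' i))
    {lam lam' : ℝ} (hl : 0 < lam) (hl' : 0 < lam') :
    Summable (fun i => klFn (cpq lam p i) (cpq lam' p' i)) ∧
      ∑' i, klFn (cpq lam p i) (cpq lam' p' i) ≤
        lam * KL p p' + (lam' - lam + lam * Real.log (lam / lam')) := by
  refine hasSubgradient_klFn.tsum_cpq_le (b := fun n s t => s * (n * KL p p') + klFn s t)
    hp hp' hac (fun n s t hs ht hst => ?_) (fun s t _ _ => by simp)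
    (fun n s t hs ht hst => ?_) hl hl' ?_
  · have := KL_nonneg hp hp' hac hK
    have := klFn_nonneg hs ht hst
    positivity
  · have h := (((hp.hasSum.mul_left (s * (n * KL p p') + s * Real.log (s / t))).add
      (hK.hasSum.mul_left s)).sub (hp.hasSum.mul_left s)).add (hp'.hasSum.mul_left t)
    convert! h using 1
    · funext j
      have := mul_mul_comp_log id hst (hac j)
      simp only [id] at this
      simp only [klFn, this]
      ring
    · rw [← KL.eq_1]
      simp only [klFn]
      push_cast
      ring
  · have h := ((((hasSum_poissonWeight_mul lam).mul_left (KL p p' + Real.log (lam / lam'))).add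
      ((hasSum_poissonWeight lam).mul_left (lam' - lam))).sub (hasSum_poissonWeight lam)).add
      (hasSum_poissonWeight lam')
    convert! h using 1
    · funext n
      simp only [klFn, log_poissonWeight_div hl hl']
      ring
    · ring

theorem posSqLogFn_cpq_le (hp : IsPMF p) (hp' : IsPMF p') (hac : ∀ i, p' i = 0 → p i = 0)
    (hK : Summable fun i => p i * Real.log (p i / p' i))
    (hV : Summable fun i => p i * Real.log (p i / p' i) ^ 2)
    {lam lam' : ℝ} (hl : 0 < lam) (hl' : 0 < lam') :
    Summable (fun i => posSqLogFn (cpq lam p i) (cpq lam' p' i)) ∧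
      ∑' i, posSqLogFn (cpq lam p i) (cpq lam' p' i) ≤
        lam * (Vd p p' - KL p p' ^ 2) + (lam' - lam) ^ 2
        + 2 * (lam' - lam) * (Real.log (lam / lam') + KL p p') * lam
        + (Real.log (lam / lam') + KL p p') ^ 2 * (lam ^ 2 + lam) := by
  refine hasSubgradient_posSqLogFn.tsum_cpq_le
    (b := fun n s t => s * (n * (Vd p p' - KL p p' ^ 2) + (Real.log (s / t) + n * KL p p') ^ 2))
    hp hp' hac (fun n s t hs ht hst => ?_) (fun s t hs _ => ?_)
    (fun n s t hs ht hst => ?_) hl hl' ?_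
  · have := sub_nonneg.2 (KL_sq_le_Vd hp hK hV)
    positivity
  · simp only [posSqLogFn, Nat.cast_zero, zero_mul, zero_add, add_zero]
    refine mul_le_mul_of_nonneg_left ?_ hs
    rcases le_total 0 (Real.log (s / t)) with h | h
    · rw [max_eq_left h]
    · rw [max_eq_right h, zero_pow two_ne_zero]; exact sq_nonneg _
  · set c := Real.log (s / t) + n * KL p p' with hc
    have h := (((hp.hasSum.mul_left (s * (n * (Vd p p' - KL p p' ^ 2) + c ^ 2))).add
      (hK.hasSum.mul_left (2 * s * c)))).add (hV.hasSum.mul_left s)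
    convert! h using 1
    · funext j
      have := mul_mul_comp_log (fun x => n * (Vd p p' - KL p p' ^ 2) + (x + n * KL p p') ^ 2)
        hst (hac j)
      rw [this, hc]
      ring
    · rw [← KL.eq_1, ← Vd.eq_1, hc]
      push_cast
      ring
  · have h := ((((hasSum_poissonWeight_mul lam).mul_left (Vd p p' - KL p p' ^ 2)).add
      ((hasSum_poissonWeight lam).mul_left ((lam' - lam) ^ 2))).add
      ((hasSum_poissonWeight_mul lam).mul_left
        (2 * (lam' - lam) * (Real.log (lam / lam') + KL p p')))).add
      ((hasSum_poissonWeight_mul_sq lam).mul_left ((Real.log (lam / lam') + KL p p') ^ 2))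
    convert! h using 1
    · funext n
      simp only [log_poissonWeight_div hl hl']
      ring
    · ring

theorem summable_sqrt_mul_sqrt (hp : IsPMF p) (hp' : IsPMF p') :
    Summable fun i => Real.sqrt (p i) * Real.sqrt (p' i) := by
  refine Summable.of_nonneg_of_le (fun i => by positivity) (fun i => ?_)
    (hp.hasSum.summable.add hp'.hasSum.summable)
  have h := sq_nonneg (Real.sqrt (p i) - Real.sqrt (p' i))
  have h2 := hellFn_eq (hp.1 i) (hp'.1 i)
  unfold hellFn at h2
  have : 0 ≤ Real.sqrt (p i) * Real.sqrt (p' i) := by positivity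
  linarith

theorem hasSum_hellFn (hp : IsPMF p) (hp' : IsPMF p') :
    HasSum (fun i => hellFn (p i) (p' i)) (hellSq p p') := by
  refine Summable.hasSum (f := fun i => hellFn (p i) (p' i)) ?_
  simp_rw [fun i => hellFn_eq (hp.1 i) (hp'.1 i)]
  exact (hp.hasSum.summable.add hp'.hasSum.summable).sub
    ((summable_sqrt_mul_sqrt hp hp').mul_left 2)

theorem hellSq_eq (hp : IsPMF p) (hp' : IsPMF p') :
    hellSq p p' = 2 - 2 * ∑' i, Real.sqrt (p i) * Real.sqrt (p' i) := by
  have h := (hp.hasSum.add hp'.hasSum).sub ((summable_sqrt_mul_sqrt hp hp').hasSum.mul_left 2)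
  simp_rw [← fun i => hellFn_eq (hp.1 i) (hp'.1 i)] at h
  rw [(hasSum_hellFn hp hp').unique h]
  ring

theorem sqrt_poissonWeight_mul {lam lam' : ℝ} (hl : 0 < lam) (hl' : 0 < lam') (n : ℕ) :
    Real.sqrt (poissonWeight lam n) * Real.sqrt (poissonWeight lam' n)
      = Real.exp (-(lam + lam') / 2) *
        ((Real.sqrt lam * Real.sqrt lam') ^ n / (Nat.factorial n : ℝ)) := by
  rw [← Real.sqrt_mul (poissonWeight_pos hl n).le, Real.sqrt_eq_iff_eq_sq
    (mul_nonneg (poissonWeight_pos hl n).le (poissonWeight_pos hl' n).le) (by positivity)]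
  rw [mul_pow, ← Real.exp_nat_mul, div_pow, ← pow_mul, mul_comm n 2, pow_mul, mul_pow,
    Real.sq_sqrt hl.le, Real.sq_sqrt hl'.le, mul_pow]
  have : Real.exp (((2 : ℕ) : ℝ) * (-(lam + lam') / 2)) = Real.exp (-lam) * Real.exp (-lam') := by
    rw [← Real.exp_add]; congr 1; push_cast; ring
  rw [this]
  unfold poissonWeight
  field_simp

theorem hellFn_cpq_le (hp : IsPMF p) (hp' : IsPMF p') (hac : ∀ i, p' i = 0 → p i = 0)
    {lam lam' : ℝ} (hl : 0 < lam) (hl' : 0 < lam') :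
    Summable (fun i => hellFn (cpq lam p i) (cpq lam' p' i)) ∧
      ∑' i, hellFn (cpq lam p i) (cpq lam' p' i) ≤
        Real.sqrt lam * Real.sqrt lam' * hellSq p p'
          + (Real.sqrt lam - Real.sqrt lam') ^ 2 := by
  set A := ∑' i, Real.sqrt (p i) * Real.sqrt (p' i) with hA
  have hA0 : 0 ≤ A := tsum_nonneg fun i => by positivity
  have hA1 : A ≤ 1 := by
    have := (hasSum_hellFn hp hp').nonneg fun i => sq_nonneg _
    linarith [hellSq_eq hp hp']
  set r := Real.sqrt lam * Real.sqrt lam' with hr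
  have key : Summable (fun i => hellFn (cpq lam p i) (cpq lam' p' i)) ∧
      ∑' i, hellFn (cpq lam p i) (cpq lam' p' i) ≤
        2 - 2 * Real.exp (-(lam + lam') / 2 + r * A) := by
    refine hasSubgradient_hellFn.tsum_cpq_le
      (b := fun n s t => s + t - 2 * (Real.sqrt s * Real.sqrt t * A ^ n))
      hp hp' hac (fun n s t hs ht hst => ?_) (fun s t hs ht => ?_)
      (fun n s t hs ht hst => ?_) hl hl' ?_
    · have h1 : Real.sqrt s * Real.sqrt t * A ^ n ≤ Real.sqrt s * Real.sqrt t :=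
        mul_le_of_le_one_right (by positivity) (pow_le_one₀ hA0 hA1)
      have h2 : 0 ≤ hellFn s t := sq_nonneg _
      rw [hellFn_eq hs ht] at h2
      linarith
    · simp [hellFn_eq hs ht]
    · have h := ((hp.hasSum.mul_left s).add (hp'.hasSum.mul_left t)).sub
        ((summable_sqrt_mul_sqrt hp hp').hasSum.mul_left (2 * (Real.sqrt s * Real.sqrt t) * A ^ n))
      convert! h using 1
      · funext j
        rw [Real.sqrt_mul hs, Real.sqrt_mul ht]
        ring
      · rw [← hA]
        ring
    · have h := ((hasSum_poissonWeight lam).add (hasSum_poissonWeight lam')).sub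
        ((NormedSpace.expSeries_div_hasSum_exp (r * A)).mul_left
          (2 * Real.exp (-(lam + lam') / 2)))
      rw [← Real.exp_eq_exp_ℝ] at h
      convert! h using 1
      · funext n
        rw [sqrt_poissonWeight_mul hl hl', mul_pow]
        ring
      · rw [Real.exp_add]
        ring
  refine ⟨key.1, key.2.trans ?_⟩
  have h := Real.add_one_le_exp (-(lam + lam') / 2 + r * A)
  have h2 := hellFn_eq hl.le hl'.le
  unfold hellFn at h2
  rw [hellSq_eq hp hp', h2]
  linarith

end Bounds

theorem abs_log_div_le {a x y : ℝ} (ha : 0 < a) (hx : a ≤ x) (hy : a ≤ y) :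
    |Real.log (x / y)| ≤ |x - y| / a := by
  have hx0 := ha.trans_le hx
  have hy0 := ha.trans_le hy
  have bound : ∀ z, a ≤ z → ∀ w, 0 < w → w / z - 1 ≤ |w - z| / a := fun z hz w hw => by
    have hz0 := ha.trans_le hz
    calc w / z - 1 = (w - z) / z := by field_simp
      _ ≤ |w - z| / z := by gcongr; exact le_abs_self _
      _ ≤ |w - z| / a := by gcongr
  refine abs_le'.2 ⟨?_, ?_⟩
  · exact (Real.log_le_sub_one_of_pos (div_pos hx0 hy0)).trans (bound y hy x hx0)
  · rw [← Real.log_inv, inv_div, abs_sub_comm]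
    exact (Real.log_le_sub_one_of_pos (div_pos hy0 hx0)).trans (bound x hx y hy0)

theorem sq_sqrt_sub_sqrt_le {a x y : ℝ} (ha : 0 < a) (hx : a ≤ x) (hy : a ≤ y) :
    (Real.sqrt x - Real.sqrt y) ^ 2 ≤ (x - y) ^ 2 / a := by
  have hx0 := ha.trans_le hx
  have hy0 := ha.trans_le hy
  rw [le_div_iff₀ ha]
  have h1 : x - y = (Real.sqrt x - Real.sqrt y) * (Real.sqrt x + Real.sqrt y) := by
    linear_combination -Real.sq_sqrt hx0.le + Real.sq_sqrt hy0.le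
  have h2 : a ≤ (Real.sqrt x + Real.sqrt y) ^ 2 := by
    nlinarith [Real.sq_sqrt hx0.le, Real.sqrt_nonneg x, Real.sqrt_nonneg y,
      mul_nonneg (Real.sqrt_nonneg x) (Real.sqrt_nonneg y)]
  rw [h1, mul_pow]
  gcongr

/-- For 0 < Λ̲ ≤ Λ̄ there is C̄ > 0, depending only on Λ̲, Λ̄, such that for all
λ, λ′ ∈ [Λ̲, Λ̄] and pmfs p, p′: KL(q,q′) ≤ C̄(KL(p,p′) + |λ−λ′|),
V(q,q′) ≤ C̄(V(p,p′) + KL(p,p′) + (λ−λ′)²), and h(q,q′) ≤ C̄·h(p,p′) + |√λ−√λ′|. -/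
theorem stmt19 (Λlo Λhi : ℝ) (h1 : 0 < Λlo) (h2 : Λlo ≤ Λhi) :
    ∃ C > (0 : ℝ), ∀ lam lam' : ℝ, lam ∈ Set.Icc Λlo Λhi → lam' ∈ Set.Icc Λlo Λhi →
      ∀ p p' : ℕ → ℝ, IsPMF p → IsPMF p' → p 0 = 0 → p' 0 = 0 →
        (∀ i, 0 < p i → 0 < p' i) →
        (Summable fun i => p i * Real.log (p i / p' i)) →
        (Summable fun i => p i * (Real.log (p i / p' i)) ^ 2) →
        KL (cpq lam p) (cpq lam' p') ≤ C * (KL p p' + |lam - lam'|) ∧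
        Vd (cpq lam p) (cpq lam' p') ≤ C * (Vd p p' + KL p p' + (lam - lam') ^ 2) ∧
        hell (cpq lam p) (cpq lam' p') ≤
          C * hell p p' + |Real.sqrt lam - Real.sqrt lam'| := by
  have hhi : 0 < Λhi := h1.trans_le h2
  set C₁ := Λhi + 1 + Λhi / Λlo with hC₁
  set M := Λhi ^ 2 + Λhi with hM
  set C₂ := Λhi + 2 + 2 * (Λhi ^ 2 + M) * (1 / Λlo ^ 2 + 1) + 4 * Λhi + 4 / Λlo with hC₂
  have hC₁0 : 0 < C₁ := by positivity
  have hM0 : 0 < M := by positivity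
  have hC₂0 : 0 < C₂ := by positivity
  refine ⟨C₁ + C₂ + Real.sqrt Λhi, by positivity, ?_⟩
  intro lam lam' hlam hlam' p p' hp hp' _ _ hpos hK hV
  have hac : ∀ i, p' i = 0 → p i = 0 := fun i h =>
    (hp.1 i).antisymm' (not_lt.1 fun h' => (hpos i h').ne' h)
  have hl : 0 < lam := h1.trans_le hlam.1
  have hl' : 0 < lam' := h1.trans_le hlam'.1
  have hK0 := KL_nonneg hp hp' hac hK
  have hKV := KL_sq_le_Vd hp hK hV
  have hV0 : 0 ≤ Vd p p' := (sq_nonneg _).trans hKV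
  have hsC := Real.sqrt_nonneg Λhi
  have hlog := abs_log_div_le h1 hlam.1 hlam'.1
  have hD := abs_nonneg (lam - lam')
  have hq := hasSum_cpq hl hp
  have hq' := hasSum_cpq hl' hp'
  obtain ⟨hHs, hH⟩ := hellFn_cpq_le hp hp' hac hl hl'
  have hr : Real.sqrt lam * Real.sqrt lam' ≤ Λhi := by
    calc Real.sqrt lam * Real.sqrt lam' ≤ Real.sqrt Λhi * Real.sqrt Λhi := by
          gcongr
          exacts [hlam.2, hlam'.2]
      _ = Λhi := Real.mul_self_sqrt hhi.le
  have hh0 : 0 ≤ hellSq p p' := (hasSum_hellFn hp hp').nonneg fun i => sq_nonneg _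
  refine ⟨?_, ?_, ?_⟩
  · obtain ⟨hs, hle⟩ := klFn_cpq_le hp hp' hac hK hl hl'
    have h := (hs.hasSum.add hq).sub hq'
    have hKL : KL (cpq lam p) (cpq lam' p') = ∑' i, klFn (cpq lam p i) (cpq lam' p' i) := by
      rw [add_sub_cancel_right] at h
      rw [← h.tsum_eq]
      exact tsum_congr fun i => by unfold klFn; ring
    rw [hKL]
    calc _ ≤ _ := hle
      _ ≤ Λhi * KL p p' + (|lam - lam'| + Λhi * (|lam - lam'| / Λlo)) := by
          refine add_le_add (mul_le_mul_of_nonneg_right hlam.2 hK0) (add_le_add ?_ ?_)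
          · rw [abs_sub_comm]; exact le_abs_self _
          · calc _ ≤ lam * (|lam - lam'| / Λlo) :=
                  mul_le_mul_of_nonneg_left ((le_abs_self _).trans hlog) hl.le
              _ ≤ _ := by gcongr; exact hlam.2
      _ ≤ C₁ * (KL p p' + |lam - lam'|) := by
          have e1 : 0 ≤ Λhi / Λlo * KL p p' := by positivity
          have e2 : 0 ≤ Λhi * |lam - lam'| := by positivity
          rw [hC₁]
          linear_combination e1 + e2 + hK0
      _ ≤ _ := by gcongr; linarith
  · obtain ⟨hs, hle⟩ := posSqLogFn_cpq_le hp hp' hac hK hV hl hl'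
    have hup : HasSum (fun i => posSqLogFn (cpq lam p i) (cpq lam' p' i)
        + 4 * hellFn (cpq lam p i) (cpq lam' p' i)) _ := hs.hasSum.add (hHs.hasSum.mul_left 4)
    have hpt := fun i => mul_log_div_sq_le (cpq_nonneg hl hp i) (cpq_nonneg hl' hp' i)
    have hVd : Vd (cpq lam p) (cpq lam' p') ≤ _ := hasSum_le hpt (Summable.of_nonneg_of_le
      (fun i => mul_nonneg (cpq_nonneg hl hp i) (sq_nonneg _)) hpt hup.summable).hasSum hup
    have hhK : hellSq p p' ≤ KL p p' := hasSum_le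
      (fun i => hellFn_le_klFn (hp.1 i) (hp'.1 i) (hac i)) (hasSum_hellFn hp hp')
      (hasSum_klFn hp hp' hK)
    have hH' : ∑' i, hellFn (cpq lam p i) (cpq lam' p' i)
        ≤ Λhi * KL p p' + (lam - lam') ^ 2 / Λlo := by
      refine hH.trans (add_le_add ?_ (sq_sqrt_sub_sqrt_le h1 hlam.1 hlam'.1))
      exact mul_le_mul hr hhK hh0 hhi.le
    set ℓ := Real.log (lam / lam') with hℓ
    have hℓ2 : ℓ ^ 2 ≤ (lam - lam') ^ 2 / Λlo ^ 2 := by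
      rw [← sq_abs ℓ, ← sq_abs (lam - lam'), ← div_pow]
      gcongr
    set d := ℓ + KL p p' with hd
    have hd2 : d ^ 2 ≤ 2 * ((lam - lam') ^ 2 / Λlo ^ 2 + Vd p p') := by
      nlinarith [sq_nonneg (ℓ - KL p p')]
    have hle' : ∑' i, posSqLogFn (cpq lam p i) (cpq lam' p' i)
        ≤ Λhi * Vd p p' + 2 * (lam - lam') ^ 2
          + (Λhi ^ 2 + M) * (2 * ((lam - lam') ^ 2 / Λlo ^ 2 + Vd p p')) := by
      calc _ ≤ _ := hle
        _ ≤ lam * Vd p p' + 2 * (lam - lam') ^ 2 + (lam ^ 2 + (lam ^ 2 + lam)) * d ^ 2 := by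
            nlinarith [sq_nonneg (lam' - lam - d * lam), mul_nonneg hl.le (sq_nonneg (KL p p'))]
        _ ≤ _ := by
            rw [hM]
            have := hlam.2
            gcongr
    have hX : 0 ≤ (lam - lam') ^ 2 := sq_nonneg _
    calc _ ≤ _ := hVd
      _ ≤ _ := add_le_add hle' (mul_le_mul_of_nonneg_left hH' (by norm_num))
      _ ≤ C₂ * (Vd p p' + KL p p' + (lam - lam') ^ 2) := by
          rw [hC₂]
          have e1 : 0 ≤ (2 + 2 * (Λhi ^ 2 + M) * (1 / Λlo ^ 2) + 4 * Λhi + 4 / Λlo) * Vd p p' := by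
            positivity
          have e2 : 0 ≤ (Λhi + 2 + 2 * (Λhi ^ 2 + M) * (1 / Λlo ^ 2 + 1) + 4 / Λlo) * KL p p' := by
            positivity
          have e3 : 0 ≤ (Λhi + 2 * (Λhi ^ 2 + M) + 4 * Λhi) * (lam - lam') ^ 2 := by positivity
          linear_combination e1 + e2 + e3
      _ ≤ _ := by gcongr; linarith
  · have hs2 : 0 ≤ |Real.sqrt lam - Real.sqrt lam'| := abs_nonneg _
    have hhn : 0 ≤ hell p p' := Real.sqrt_nonneg _
    have hsq : hell p p' ^ 2 = hellSq p p' := Real.sq_sqrt hh0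
    calc hell (cpq lam p) (cpq lam' p')
        ≤ Real.sqrt Λhi * hell p p' + |Real.sqrt lam - Real.sqrt lam'| := by
          refine Real.sqrt_le_iff.2 ⟨by positivity, hH.trans ?_⟩
          rw [add_sq, mul_pow, Real.sq_sqrt hhi.le, hsq, sq_abs]
          have h3 := mul_le_mul_of_nonneg_right hr hh0
          have : 0 ≤ 2 * (Real.sqrt Λhi * hell p p') * |Real.sqrt lam - Real.sqrt lam'| := by
            positivity
          linarith
      _ ≤ _ := by gcongr; linarith
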